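/- The quotient ℚ-algebra R̃ = B/J is generated, as a ℚ-algebra, by the image of y together with the images of the variables x_{0,2}, x_{0,4}, …, x_{0,2⌊g/3⌋} (by the image of y alone if ⌊g/3⌋ = 0). -/

import Mathlib

open MvPolynomial

/-- The index set `S_g` of pairs `(i,j)` of integers. -/
def Sg (g : ℕ) : Set (ℤ × ℤ) :=
  {p | 0 ≤ p.1 ∧ 0 ≤ p.2 ∧ p.2 ≤ 2 * (g : ℤ) - 2 ∧ p.1 ≤ p.2 + 2 ∧
    Even (p.1 + p.2) ∧ p ≠ (0, 0)}

/-- The variables of the polynomial algebra `𝒜`: one variable `x_{i,j}` for each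
`(i,j) ∈ S_g`, plus one extra variable `y`. -/
abbrev JacVar (g : ℕ) := {p : ℤ × ℤ // p ∈ Sg g} ⊕ Unit

/-- The polynomial algebra `𝒜` over `ℚ`. -/
abbrev JacA (g : ℕ) := MvPolynomial (JacVar g) ℚ

open Classical in
/-- The element `x_{i,j}` of `𝒜`, with the conventions `x_{0,0} = g` and `x_{i,j} = 0` for
`(i,j) ∉ S_g ∪ {(0,0)}`. -/
noncomputable def Xv (g : ℕ) (i j : ℤ) : JacA g :=
  if h : (i, j) ∈ Sg g then X (Sum.inl ⟨(i, j), h⟩)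
  else if (i, j) = ((0 : ℤ), (0 : ℤ)) then C (g : ℚ) else 0

/-- The element `y` of `𝒜`. -/
noncomputable def Yv (g : ℕ) : JacA g := X (Sum.inr ())

/-- The bigrading: `x_{i,j}` has bidegree `(i,j)` and `y` has bidegree `(0,2)`. -/
def wt (g : ℕ) : JacVar g → ℤ × ℤ
  | Sum.inl p => p.1
  | Sum.inr _ => (0, 2)

/-- The bihomogeneous component `𝒜_{(i,j)}`. -/
noncomputable def Acomp (g : ℕ) (i j : ℤ) : Submodule ℚ (JacA g) :=
  weightedHomogeneousSubmodule ℚ (wt g) (i, j)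

/-- Binomial coefficient `binom(n,r)` for integers, equal to `0` unless `0 ≤ r ≤ n`. -/
def ibinom (n r : ℤ) : ℚ :=
  if 0 ≤ r ∧ r ≤ n then (n.toNat.choose r.toNat : ℚ) else 0

open Classical in
/-- The (finite) set `S_g` as a `Finset` of pairs of integers. -/
noncomputable def SgFinset (g : ℕ) : Finset (ℤ × ℤ) :=
  ((Finset.Icc (0 : ℤ) (2 * (g : ℤ))) ×ˢ (Finset.Icc (0 : ℤ) (2 * (g : ℤ)))).filter
    (· ∈ Sg g)

open Classical in
/-- Partial derivative `∂x_{i,j}` (zero if `(i,j) ∉ S_g`). -/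
noncomputable def pd (g : ℕ) (p : ℤ × ℤ) (P : JacA g) : JacA g :=
  if h : p ∈ Sg g then pderiv (Sum.inl ⟨p, h⟩) P else 0

/-- The operator `E`: multiplication by `x_{2,0}`. -/
noncomputable def Eop (g : ℕ) (P : JacA g) : JacA g := Xv g 2 0 * P

/-- The differential operator `F`. -/
noncomputable def Fop (g : ℕ) (P : JacA g) : JacA g :=
  (1 / 2 : ℚ) • (∑ p ∈ SgFinset g, ∑ q ∈ SgFinset g,
      (Yv g * Xv g (p.1 - 1) (p.2 - 1) * Xv g (q.1 - 1) (q.2 - 1)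
        - C (ibinom (p.1 + q.1 - 2) (p.1 - 1)) * Xv g (p.1 + q.1 - 2) (p.2 + q.2))
      * pd g p (pd g q P))
  + ∑ p ∈ SgFinset g, Xv g (p.1 - 2) p.2 * pd g p P

/-- The subalgebra `B = ⊕_{i≥0} 𝒜_{(0,2i)}` of `𝒜`, i.e. the polynomial subalgebra
generated by the variables `x_{0,2}, x_{0,4}, …, x_{0,2g−2}` and `y`. -/
noncomputable def Bsub (g : ℕ) : Subalgebra ℚ (JacA g) :=
  Algebra.adjoin ℚ
    ({Yv g} ∪ {P | ∃ k : ℤ, 1 ≤ k ∧ k ≤ (g : ℤ) - 1 ∧ P = Xv g 0 (2 * k)})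

/-- The ideal `J ⊆ B` generated by the elements `F^{g+1}(m)`, where `m` runs over the
monomials of `𝒜` of bidegree `(2g+2, 2i)` for all `i ≥ 0`. -/
noncomputable def Jid (g : ℕ) : Ideal (Bsub g) :=
  Ideal.span {b : Bsub g | ∃ (i : ℕ) (m : JacVar g →₀ ℕ),
    (monomial m (1 : ℚ)) ∈ Acomp g (2 * (g : ℤ) + 2) (2 * (i : ℤ)) ∧
    (b : JacA g) = (Fop g)^[g + 1] (monomial m (1 : ℚ))}

section PartialDerivatives

lemma pd_add (g : ℕ) (p : ℤ × ℤ) (P Q : JacA g) : pd g p (P + Q) = pd g p P + pd g p Q := by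
  unfold pd; split_ifs <;> simp

lemma pd_C (g : ℕ) (p : ℤ × ℤ) (c : ℚ) : pd g p (C c) = 0 := by
  unfold pd; split_ifs <;> simp

lemma pd_mul (g : ℕ) (p : ℤ × ℤ) (P Q : JacA g) :
    pd g p (P * Q) = pd g p P * Q + P * pd g p Q := by
  unfold pd; split_ifs
  · exact pderiv_mul
  · simp

lemma pd_C_mul (g : ℕ) (p : ℤ × ℤ) (c : ℚ) (P : JacA g) :
    pd g p (C c * P) = C c * pd g p P := by
  rw [pd_mul, pd_C]; ring

lemma pd_Yv (g : ℕ) (p : ℤ × ℤ) : pd g p (Yv g) = 0 := by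
  unfold pd Yv; split_ifs
  · exact pderiv_X_of_ne (by simp)
  · rfl

lemma pd_neg (g : ℕ) (p : ℤ × ℤ) (P : JacA g) : pd g p (-P) = -pd g p P := by
  unfold pd; split_ifs <;> simp

lemma Xv_of_mem {g : ℕ} {i j : ℤ} (h : (i, j) ∈ Sg g) :
    Xv g i j = X (Sum.inl ⟨(i, j), h⟩) := by
  simp [Xv, h]

lemma pd_Xv_self {g : ℕ} {i j : ℤ} (h : (i, j) ∈ Sg g) : pd g (i, j) (Xv g i j) = 1 := by
  rw [Xv_of_mem h, pd, dif_pos h, pderiv_X_self]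

lemma pd_Xv_of_ne {g : ℕ} {p : ℤ × ℤ} {i j : ℤ} (h : p ≠ (i, j)) : pd g p (Xv g i j) = 0 := by
  unfold pd Xv
  split_ifs
  · exact pderiv_X_of_ne (by simpa using h.symm)
  · exact pderiv_C
  · exact map_zero _
  · rfl

lemma mem_SgFinset {g : ℕ} {p : ℤ × ℤ} : p ∈ SgFinset g ↔ p ∈ Sg g := by
  simp only [SgFinset, Finset.mem_filter, Finset.mem_product, Finset.mem_Icc, and_iff_right_iff_imp]
  rintro ⟨h1, h2, h3, h4, -, -⟩
  omega

lemma Fop_add (g : ℕ) (P Q : JacA g) : Fop g (P + Q) = Fop g P + Fop g Q := by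
  unfold Fop
  rw [add_add_add_comm, ← smul_add, ← Finset.sum_add_distrib, ← Finset.sum_add_distrib]
  refine congrArg₂ (· + ·) (congrArg ((1 / 2 : ℚ) • ·) (Finset.sum_congr rfl fun p _ => ?_))
    (Finset.sum_congr rfl fun p _ => ?_)
  · rw [← Finset.sum_add_distrib]
    refine Finset.sum_congr rfl fun q _ => ?_
    rw [pd_add, pd_add, mul_add]
  · rw [pd_add, mul_add]

lemma Fop_C_mul (g : ℕ) (c : ℚ) (P : JacA g) : Fop g (C c * P) = C c * Fop g P := by
  unfold Fop
  rw [mul_add, mul_smul_comm, Finset.mul_sum, Finset.mul_sum]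
  refine congrArg₂ (· + ·) (congrArg ((1 / 2 : ℚ) • ·) (Finset.sum_congr rfl fun p _ => ?_))
    (Finset.sum_congr rfl fun p _ => ?_)
  · rw [Finset.mul_sum]
    refine Finset.sum_congr rfl fun q _ => ?_
    rw [pd_C_mul, pd_C_mul, mul_left_comm]
  · rw [pd_C_mul, mul_left_comm]

end PartialDerivatives

section Bigrading

lemma Xv_mem_Acomp (g : ℕ) (i j : ℤ) : Xv g i j ∈ Acomp g i j := by
  unfold Xv
  split_ifs with h1 h2
  · exact isWeightedHomogeneous_X ℚ (wt g) (Sum.inl ⟨(i, j), h1⟩)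
  · obtain ⟨rfl, rfl⟩ := Prod.mk.inj h2
    exact isWeightedHomogeneous_C (wt g) (g : ℚ)
  · exact zero_mem _

lemma Yv_mem_Acomp (g : ℕ) : Yv g ∈ Acomp g 0 2 :=
  isWeightedHomogeneous_X ℚ (wt g) (Sum.inr ())

lemma mul_mem_Acomp {g : ℕ} {a b c d i j : ℤ} {P Q : JacA g} (hP : P ∈ Acomp g a b)
    (hQ : Q ∈ Acomp g c d) (hi : a + c = i) (hj : b + d = j) : P * Q ∈ Acomp g i j := by
  subst hi hj
  exact IsWeightedHomogeneous.mul hP hQ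

lemma C_mul_mem_Acomp {g : ℕ} {a b : ℤ} {P : JacA g} (hP : P ∈ Acomp g a b) (c : ℚ) :
    C c * P ∈ Acomp g a b :=
  IsWeightedHomogeneous.C_mul hP c

lemma pd_mem_Acomp {g : ℕ} {a b : ℤ} {P : JacA g} (hP : P ∈ Acomp g a b) (p : ℤ × ℤ) :
    pd g p P ∈ Acomp g (a - p.1) (b - p.2) := by
  unfold pd
  split_ifs with h
  · intro m hm
    rw [coeff_pderiv] at hm
    have := hP (left_ne_zero_of_mul hm)
    rw [map_add, Finsupp.weight_single, one_smul] at this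
    rw [eq_sub_of_add_eq this]
    rfl
  · exact zero_mem _

lemma Fop_mem_Acomp {g : ℕ} {a b : ℤ} {P : JacA g} (hP : P ∈ Acomp g a b) :
    Fop g P ∈ Acomp g (a - 2) b := by
  refine add_mem (Submodule.smul_mem _ _ (sum_mem fun p _ => sum_mem fun q _ => ?_))
    (sum_mem fun p _ => ?_)
  · refine mul_mem_Acomp (a := p.1 + q.1 - 2) (b := p.2 + q.2) (sub_mem ?_ ?_)
      (pd_mem_Acomp (pd_mem_Acomp hP q) p) (by ring) (by ring)
    · refine mul_mem_Acomp (mul_mem_Acomp (Yv_mem_Acomp g) (Xv_mem_Acomp g _ _) rfl rfl)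
        (Xv_mem_Acomp g _ _) (by ring) (by ring)
    · exact C_mul_mem_Acomp (Xv_mem_Acomp g _ _) _
  · exact mul_mem_Acomp (Xv_mem_Acomp g _ _) (pd_mem_Acomp hP p) (by ring) (by ring)

lemma Fop_iterate_mem_Acomp {g : ℕ} {a b : ℤ} {P : JacA g} (hP : P ∈ Acomp g a b) (n : ℕ) :
    (Fop g)^[n] P ∈ Acomp g (a - 2 * n) b := by
  induction n with
  | zero => simpa using hP
  | succ n ih =>
    rw [Function.iterate_succ_apply']
    convert Fop_mem_Acomp ih using 2
    push_cast; ring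

lemma wt_nonneg (g : ℕ) (v : JacVar g) : 0 ≤ wt g v := by
  rcases v with ⟨p, h⟩ | u
  · exact ⟨h.1, h.2.1⟩
  · exact ⟨le_rfl, by simp [wt]⟩

lemma wt_ne_zero (g : ℕ) (v : JacVar g) : wt g v ≠ 0 := by
  rcases v with ⟨p, h⟩ | u
  · exact h.2.2.2.2.2
  · simp [wt]

/-- A monomial of bidegree `(0,2d)` other than `x_{0,2d}` involves only `y` and the `x_{0,2k}`
with `k < d`. -/
lemma eq_single_or_of_weight_eq {g : ℕ} {d : ℤ} {s : JacVar g →₀ ℕ}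
    (hs : Finsupp.weight (wt g) s = (0, 2 * d)) :
    (∃ h : ((0 : ℤ), 2 * d) ∈ Sg g, s = Finsupp.single (Sum.inl ⟨(0, 2 * d), h⟩) 1) ∨
      ∀ v ∈ s.support, X v = Yv g ∨
        ∃ k : ℤ, 1 ≤ k ∧ k < d ∧ k ≤ (g : ℤ) - 1 ∧ X v = Xv g 0 (2 * k) := by
  by_contra! hcon
  obtain ⟨hne, v, hv, hvY, hvX⟩ := hcon
  have hsv : s v ≠ 0 := Finsupp.mem_support_iff.mp hv
  have hle := Finsupp.le_weight_of_ne_zero (wt_nonneg g) hsv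
  rw [hs] at hle
  rcases v with ⟨⟨i, j⟩, h⟩ | u
  · obtain ⟨h1, h2⟩ := hle
    obtain ⟨hi, hj, hj2, -, ⟨r, hr⟩, h00⟩ := id h
    simp only [wt] at h1 h2 hi hj hj2 hr
    obtain rfl : i = 0 := le_antisymm h1 hi
    obtain rfl : j = 2 * r := by omega
    have hr0 : r ≠ 0 := by rintro rfl; exact h00 rfl
    rcases lt_or_ge r d with hrd | hrd
    · exact hvX r (by omega) hrd (by omega) (Xv_of_mem h).symm
    · obtain rfl : r = d := by omega
      refine hne h ?_
      have hw := Finsupp.weight_sub_single_add (w := wt g) hsv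
      rw [hs] at hw
      have hz : Finsupp.weight (wt g) (s - Finsupp.single (Sum.inl ⟨(0, 2 * r), h⟩) 1) = 0 :=
        add_eq_right.mp hw
      have hz' : s - Finsupp.single (Sum.inl ⟨(0, 2 * r), h⟩) 1 = 0 := by
        ext u
        by_contra hu
        have := Finsupp.le_weight_of_ne_zero (wt_nonneg g) hu
        rw [hz] at this
        exact wt_ne_zero g u (le_antisymm this (wt_nonneg g u))
      rw [← Finsupp.sub_add_single_one_cancel hsv, hz', zero_add]
  · exact hvY rfl

lemma monomial_mem_of_forall_X_mem {σ : Type*} (S : Subalgebra ℚ (MvPolynomial σ ℚ))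
    {s : σ →₀ ℕ} (h : ∀ v ∈ s.support, X v ∈ S) (c : ℚ) : monomial s c ∈ S := by
  rw [monomial_eq]
  exact mul_mem (S.algebraMap_mem c) (prod_mem fun v hv => pow_mem (h v hv) _)

/-- An element of bidegree `(0,2d)` equals its linear part in `x_{0,2d}` modulo any subalgebra
containing `y` and the `x_{0,2k}` with `k < d`. -/
lemma sub_linear_mem {g : ℕ} {d : ℤ} (S : Subalgebra ℚ (JacA g)) (hY : Yv g ∈ S)
    (hX : ∀ k : ℤ, 1 ≤ k → k < d → k ≤ (g : ℤ) - 1 → Xv g 0 (2 * k) ∈ S)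
    {P : JacA g} (hP : P ∈ Acomp g 0 (2 * d)) :
    P - C (constantCoeff (pd g (0, 2 * d) P)) * Xv g 0 (2 * d) ∈ S := by
  classical
  have key : ∀ (s : JacVar g →₀ ℕ) (c : ℚ), Finsupp.weight (wt g) s = (0, 2 * d) →
      monomial s c -
        C (constantCoeff (pd g (0, 2 * d) (monomial s c))) * Xv g 0 (2 * d) ∈ S := by
    intro s c hs
    have hcoeff : ∀ h : ((0 : ℤ), 2 * d) ∈ Sg g,
        constantCoeff (pd g (0, 2 * d) (monomial s c)) =
          if s = Finsupp.single (Sum.inl ⟨(0, 2 * d), h⟩) 1 then c else 0 := by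
      intro h
      rw [pd, dif_pos h, constantCoeff_eq, coeff_pderiv, coeff_monomial, zero_add]
      split_ifs <;> simp
    by_cases hd : ∃ h : ((0 : ℤ), 2 * d) ∈ Sg g, s = Finsupp.single (Sum.inl ⟨(0, 2 * d), h⟩) 1
    · obtain ⟨h, rfl⟩ := hd
      rw [hcoeff h, if_pos rfl, Xv_of_mem h, C_mul_X_eq_monomial, sub_self]
      exact zero_mem _
    · have hzero : constantCoeff (pd g (0, 2 * d) (monomial s c)) = 0 := by
        by_cases h : ((0 : ℤ), 2 * d) ∈ Sg g
        · rw [hcoeff h, if_neg fun hs => hd ⟨h, hs⟩]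
        · simp [pd, h]
      rw [hzero, C_0, zero_mul, sub_zero]
      refine monomial_mem_of_forall_X_mem S (fun v hv => ?_) c
      rcases (eq_single_or_of_weight_eq hs).resolve_left hd v hv with h | ⟨k, h1, h2, h3, h⟩
      · rwa [h]
      · rw [h]; exact hX k h1 h2 h3
  induction hP using IsWeightedHomogeneous.induction_on with
  | zero => simp [pd]
  | add p q hp hq ihp ihq =>
    convert add_mem ihp ihq using 1
    rw [pd_add, map_add, C_add]; ring
  | monomial s c hs => exact key s c hs

lemma Acomp_zero_le_Bsub {g : ℕ} (d : ℤ) {P : JacA g} (hP : P ∈ Acomp g 0 (2 * d)) :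
    P ∈ Bsub g := by
  have hY : Yv g ∈ Bsub g := Algebra.subset_adjoin (Or.inl rfl)
  have hX : ∀ k : ℤ, 1 ≤ k → k ≤ (g : ℤ) - 1 → Xv g 0 (2 * k) ∈ Bsub g :=
    fun k h1 h2 => Algebra.subset_adjoin (Or.inr ⟨k, h1, h2, rfl⟩)
  have h := sub_linear_mem (Bsub g) hY (fun k h1 _ h2 => hX k h1 h2) hP
  have hlin : C (constantCoeff (pd g (0, 2 * d) P)) * Xv g 0 (2 * d) ∈ Bsub g := by
    by_cases hd : ((0 : ℤ), 2 * d) ∈ Sg g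
    · have h00 := hd.2.2.2.2.2
      obtain ⟨-, h1, h2, -⟩ := hd
      have : d ≠ 0 := by rintro rfl; exact h00 rfl
      simp only at h1 h2
      exact mul_mem ((Bsub g).algebraMap_mem _) (hX d (by omega) (by omega))
    · simp [pd, hd]
  simpa using add_mem h hlin

end Bigrading

section PositiveCone

/-- The subsemiring of `𝒜` generated by the nonnegative constants, the multiples of `y` and the
elements `-x_{i,j}` with `j ≥ 1`. -/
noncomputable def positiveCone (g : ℕ) : Subsemiring (JacA g) :=
  Subsemiring.closure
    ({P | ∃ c : ℚ, 0 ≤ c ∧ P = C c} ∪ {P | Yv g ∣ P} ∪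
      {P | ∃ i j : ℤ, 1 ≤ j ∧ P = -Xv g i j})

lemma C_mem_positiveCone {g : ℕ} {c : ℚ} (hc : 0 ≤ c) : C c ∈ positiveCone g :=
  Subsemiring.subset_closure (Or.inl (Or.inl ⟨c, hc, rfl⟩))

lemma mem_positiveCone_of_dvd {g : ℕ} {P : JacA g} (h : Yv g ∣ P) : P ∈ positiveCone g :=
  Subsemiring.subset_closure (Or.inl (Or.inr h))

lemma neg_Xv_mem_positiveCone (g : ℕ) (i : ℤ) {j : ℤ} (hj : 1 ≤ j) :
    -Xv g i j ∈ positiveCone g :=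
  Subsemiring.subset_closure (Or.inr ⟨i, j, hj, rfl⟩)

lemma neg_pd_mem_positiveCone {g : ℕ} (p : ℤ × ℤ) {P : JacA g} (hP : P ∈ positiveCone g) :
    -pd g p P ∈ positiveCone g := by
  induction hP using Subsemiring.closure_induction with
  | mem P hP =>
    rcases hP with (⟨c, hc, rfl⟩ | ⟨Q, rfl⟩) | ⟨i, j, hj, rfl⟩
    · rw [pd_C, neg_zero]; exact zero_mem _
    · rw [pd_mul, pd_Yv]
      exact mem_positiveCone_of_dvd ⟨-pd g p Q, by ring⟩
    · rw [pd_neg, neg_neg]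
      by_cases h : p = (i, j)
      · subst h
        by_cases hS : (i, j) ∈ Sg g
        · rw [pd_Xv_self hS]; exact one_mem _
        · simp [pd, hS]
      · rw [pd_Xv_of_ne h]; exact zero_mem _
  | zero => simp [pd]
  | one => rw [← C_1, pd_C, neg_zero]; exact zero_mem _
  | add P Q _ _ ihP ihQ => rw [pd_add, neg_add]; exact add_mem ihP ihQ
  | mul P Q hP hQ ihP ihQ =>
    convert add_mem (mul_mem ihP hQ) (mul_mem hP ihQ) using 1
    rw [pd_mul]; ring

lemma Yv_dvd_pd {g : ℕ} (i : ℤ) {P : JacA g} (hP : P ∈ positiveCone g) :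
    Yv g ∣ pd g (i, 0) P := by
  induction hP using Subsemiring.closure_induction with
  | mem P hP =>
    rcases hP with (⟨c, hc, rfl⟩ | ⟨Q, rfl⟩) | ⟨i, j, hj, rfl⟩
    · rw [pd_C]; exact dvd_zero _
    · rw [pd_mul, pd_Yv, zero_mul, zero_add]; exact dvd_mul_right _ _
    · rw [pd_neg, pd_Xv_of_ne, neg_zero]
      · exact dvd_zero _
      · intro h
        have := (Prod.mk.inj h).2
        omega
  | zero => simp [pd]
  | one => rw [← C_1, pd_C]; exact dvd_zero _
  | add P Q _ _ ihP ihQ => rw [pd_add]; exact dvd_add ihP ihQ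
  | mul P Q _ _ ihP ihQ =>
    rw [pd_mul]; exact dvd_add (dvd_mul_of_dvd_left ihP _) (dvd_mul_of_dvd_right ihQ _)

lemma constantCoeff_nonneg {g : ℕ} {P : JacA g} (hP : P ∈ positiveCone g) :
    0 ≤ constantCoeff P := by
  induction hP using Subsemiring.closure_induction with
  | mem P hP =>
    rcases hP with (⟨c, hc, rfl⟩ | ⟨Q, rfl⟩) | ⟨i, j, hj, rfl⟩
    · simpa using hc
    · simp [Yv]
    · unfold Xv
      split_ifs with h1 h2
      · simp
      · have := (Prod.mk.inj h2).2
        omega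
      · simp
  | zero => simp
  | one => simp
  | add P Q _ _ ihP ihQ => rw [map_add]; exact add_nonneg ihP ihQ
  | mul P Q _ _ ihP ihQ => rw [map_mul]; exact mul_nonneg ihP ihQ

lemma ibinom_nonneg (n r : ℤ) : 0 ≤ ibinom n r := by
  unfold ibinom; split_ifs <;> positivity

lemma Fop_second_order_mem {g : ℕ} {P : JacA g} (hP : P ∈ positiveCone g) {p q : ℤ × ℤ}
    (hp : p ∈ Sg g) (hq : q ∈ Sg g) :
    (Yv g * Xv g (p.1 - 1) (p.2 - 1) * Xv g (q.1 - 1) (q.2 - 1)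
        - C (ibinom (p.1 + q.1 - 2) (p.1 - 1)) * Xv g (p.1 + q.1 - 2) (p.2 + q.2))
      * pd g p (pd g q P) ∈ positiveCone g := by
  have hpq : pd g p (pd g q P) ∈ positiveCone g := by
    simpa [pd_neg] using neg_pd_mem_positiveCone p (neg_pd_mem_positiveCone q hP)
  by_cases h : 1 ≤ p.2 + q.2
  · rw [sub_eq_add_neg, ← mul_neg]
    refine mul_mem (add_mem (mem_positiveCone_of_dvd ?_) ?_) hpq
    · rw [mul_assoc]; exact dvd_mul_right _ _
    · exact mul_mem (C_mem_positiveCone (ibinom_nonneg _ _)) (neg_Xv_mem_positiveCone g _ h)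
  · have h1 := hp.2.1
    have h2 := hq.2.1
    obtain ⟨p1, p2⟩ := p
    simp only at h h1
    obtain rfl : p2 = 0 := by omega
    obtain ⟨Q, hQ⟩ := Yv_dvd_pd p1 (neg_pd_mem_positiveCone q hP)
    rw [pd_neg, neg_eq_iff_eq_neg] at hQ
    refine mem_positiveCone_of_dvd (dvd_mul_of_dvd_right ?_ _)
    rw [hQ]
    exact (dvd_mul_right _ _).neg_right

lemma Fop_first_order_mem {g : ℕ} {P : JacA g} (hP : P ∈ positiveCone g) {p : ℤ × ℤ}
    (hp : p ∈ Sg g) : Xv g (p.1 - 2) p.2 * pd g p P ∈ positiveCone g := by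
  by_cases h : 1 ≤ p.2
  · rw [← neg_mul_neg]
    exact mul_mem (neg_Xv_mem_positiveCone g _ h) (neg_pd_mem_positiveCone p hP)
  · have h1 := hp.2.1
    obtain ⟨p1, p2⟩ := p
    simp only at h h1
    obtain rfl : p2 = 0 := by omega
    exact mem_positiveCone_of_dvd (dvd_mul_of_dvd_right (Yv_dvd_pd p1 hP) _)

lemma half_smul_mem_positiveCone {g : ℕ} {P : JacA g} (hP : P ∈ positiveCone g) :
    (1 / 2 : ℚ) • P ∈ positiveCone g := by
  rw [smul_eq_C_mul]
  exact mul_mem (C_mem_positiveCone (by norm_num)) hP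

lemma Fop_mem_positiveCone {g : ℕ} {P : JacA g} (hP : P ∈ positiveCone g) :
    Fop g P ∈ positiveCone g :=
  add_mem
    (half_smul_mem_positiveCone (sum_mem fun _ hp => sum_mem fun _ hq =>
      Fop_second_order_mem hP (mem_SgFinset.mp hp) (mem_SgFinset.mp hq)))
    (sum_mem fun _ hp => Fop_first_order_mem hP (mem_SgFinset.mp hp))

/-- `P` dominates `Q` if `P - c Q` lies in the positive cone for some `c > 0`. -/
def Dominates (g : ℕ) (P Q : JacA g) : Prop :=
  ∃ c : ℚ, 0 < c ∧ P - C c * Q ∈ positiveCone g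

lemma Dominates.refl {g : ℕ} (P : JacA g) : Dominates g P P :=
  ⟨1, one_pos, by simp⟩

lemma Dominates.trans {g : ℕ} {P Q R : JacA g} (h1 : Dominates g P Q) (h2 : Dominates g Q R) :
    Dominates g P R := by
  obtain ⟨c, hc, h1⟩ := h1
  obtain ⟨d, hd, h2⟩ := h2
  refine ⟨c * d, mul_pos hc hd, ?_⟩
  convert add_mem h1 (mul_mem (C_mem_positiveCone hc.le) h2) using 1
  rw [C_mul]; ring

lemma Dominates.map_Fop {g : ℕ} {P Q : JacA g} (h : Dominates g P Q) :
    Dominates g (Fop g P) (Fop g Q) := by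
  obtain ⟨c, hc, h⟩ := h
  refine ⟨c, hc, ?_⟩
  convert Fop_mem_positiveCone h using 1
  rw [sub_eq_add_neg, sub_eq_add_neg, Fop_add, ← neg_mul, ← neg_mul, ← C_neg, Fop_C_mul]

lemma Dominates.map_Fop_iterate {g : ℕ} {P Q : JacA g} (h : Dominates g P Q) (n : ℕ) :
    Dominates g ((Fop g)^[n] P) ((Fop g)^[n] Q) := by
  induction n with
  | zero => exact h
  | succ n ih => simpa only [Function.iterate_succ_apply'] using ih.map_Fop

lemma sum_sub_mem_positiveCone {g : ℕ} {ι : Type*} {s : Finset ι} {f : ι → JacA g} {i : ι}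
    (hi : i ∈ s) (hf : ∀ j ∈ s, f j ∈ positiveCone g) {Q : JacA g}
    (h : f i - Q ∈ positiveCone g) : ∑ j ∈ s, f j - Q ∈ positiveCone g := by
  classical
  rw [← Finset.add_sum_erase s f hi, add_sub_right_comm]
  exact add_mem h (sum_mem fun j hj => hf j (Finset.mem_of_mem_erase hj))

/-- Applying `F` merges two variables. -/
lemma Fop_dominates_merge {g : ℕ} {i j k l : ℤ} (hp : (i, j) ∈ Sg g) (hq : (k, l) ∈ Sg g)
    (hi : 1 ≤ i) (hk : 1 ≤ k) (hj : 1 ≤ j) (hl : 1 ≤ l) {R : JacA g} (hR : R ∈ positiveCone g) :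
    Dominates g (Fop g (-Xv g i j * (-Xv g k l * R)))
      (-Xv g (i + k - 2) (j + l) * R) := by
  set P := -Xv g i j * (-Xv g k l * R) with hPdef
  have hu := neg_Xv_mem_positiveCone g i hj
  have hv := neg_Xv_mem_positiveCone g k hl
  have hP : P ∈ positiveCone g := mul_mem hu (mul_mem hv hR)
  set b := ibinom (i + k - 2) (i - 1) with hb
  have hb0 : 0 < b := by
    rw [hb, ibinom, if_pos (by omega)]
    exact_mod_cast Nat.choose_pos (by omega)
  have hdd : pd g (i, j) (pd g (k, l) P) - R ∈ positiveCone g := by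
    have hD : ∀ {p : ℤ × ℤ} {Q : JacA g}, Q ∈ positiveCone g → -pd g p Q ∈ positiveCone g :=
      fun h => neg_pd_mem_positiveCone _ h
    have h1 : -pd g (k, l) P - -Xv g i j * R ∈ positiveCone g := by
      convert add_mem (mul_mem (hD hu (p := (k, l))) (mul_mem hv hR))
        (mul_mem hu (mul_mem hv (hD hR (p := (k, l))))) using 1
      simp only [hPdef, pd_mul, pd_neg, pd_Xv_self hq]
      ring
    convert add_mem (hD h1 (p := (i, j))) (mul_mem hu (hD hR (p := (i, j)))) using 1
    simp only [sub_eq_add_neg, pd_add, pd_mul, pd_neg, pd_Xv_self hp]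
    ring
  have hsecond := sum_sub_mem_positiveCone (g := g) (s := SgFinset g)
    (f := fun p => ∑ q ∈ SgFinset g,
      (Yv g * Xv g (p.1 - 1) (p.2 - 1) * Xv g (q.1 - 1) (q.2 - 1)
        - C (ibinom (p.1 + q.1 - 2) (p.1 - 1)) * Xv g (p.1 + q.1 - 2) (p.2 + q.2))
      * pd g p (pd g q P)) (Q := C b * (-Xv g (i + k - 2) (j + l) * R)) (mem_SgFinset.mpr hp)
    (fun p hp => sum_mem fun q hq =>
      Fop_second_order_mem hP (mem_SgFinset.mp hp) (mem_SgFinset.mp hq))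
    (sum_sub_mem_positiveCone (mem_SgFinset.mpr hq)
      (fun q hq => Fop_second_order_mem hP hp (mem_SgFinset.mp hq)) (by
        convert add_mem (mul_mem (C_mem_positiveCone (g := g) hb0.le)
          (mul_mem (neg_Xv_mem_positiveCone g (i + k - 2) (j := j + l) (by omega)) hdd))
          (mem_positiveCone_of_dvd (dvd_mul_right (Yv g)
            (Xv g (i - 1) (j - 1) * Xv g (k - 1) (l - 1) *
              pd g (i, j) (pd g (k, l) P)))) using 1
        simp only [← hb]
        ring))
  refine ⟨1 / 2 * b, by positivity, ?_⟩
  convert add_mem (half_smul_mem_positiveCone hsecond)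
    (sum_mem fun p hp => Fop_first_order_mem hP (mem_SgFinset.mp hp)) using 1
  rw [Fop, C_mul, smul_sub, smul_eq_C_mul (a := (1 / 2 : ℚ)) (C b * _)]
  ring

/-- Applying `F` lowers the first index of a variable by `2`. -/
lemma Fop_dominates_lower {g : ℕ} {i j : ℤ} (hp : (i, j) ∈ Sg g) (hj : 1 ≤ j) :
    Dominates g (Fop g (-Xv g i j)) (-Xv g (i - 2) j) := by
  have hP := neg_Xv_mem_positiveCone g i hj
  refine ⟨1, one_pos, ?_⟩
  have hfirst := sum_sub_mem_positiveCone (g := g) (s := SgFinset g)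
    (f := fun p => Xv g (p.1 - 2) p.2 * pd g p (-Xv g i j)) (Q := -Xv g (i - 2) j)
    (mem_SgFinset.mpr hp) (fun p hp => Fop_first_order_mem hP (mem_SgFinset.mp hp)) (by
      simp only [pd_neg, pd_Xv_self hp]
      simp)
  convert add_mem (half_smul_mem_positiveCone (sum_mem fun _ hp => sum_mem fun _ hq =>
    Fop_second_order_mem hP (mem_SgFinset.mp hp) (mem_SgFinset.mp hq))) hfirst using 1
  rw [Fop, C_1, one_mul, add_sub_assoc]

lemma add_two_mem_Sg {g : ℕ} {a : ℤ} (h1 : 1 ≤ a) (h2 : a ≤ 2 * (g : ℤ) - 2) :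
    (a + 2, a) ∈ Sg g := by
  refine ⟨by simp only; omega, by simp only; omega, h2, le_rfl, ⟨a + 1, by simp only; ring⟩, ?_⟩
  intro h
  have := (Prod.mk.inj h).2
  omega

lemma Fop_iterate_dominates_merge {g : ℕ} (n : ℕ) {a : ℤ} (h1 : 1 ≤ a)
    (h2 : a + n ≤ 2 * (g : ℤ) - 2) :
    Dominates g ((Fop g)^[n] (-Xv g (a + 2) a * (-Xv g 3 1) ^ n))
      (-Xv g (a + n + 2) (a + n)) := by
  induction n generalizing a with
  | zero => simpa using Dominates.refl _
  | succ n ih =>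
    push_cast at h2 ⊢
    have hmerge := Fop_dominates_merge (g := g) (add_two_mem_Sg h1 (by omega))
      (add_two_mem_Sg (a := 1) le_rfl (by omega)) (by omega) (by omega) h1 le_rfl
      (pow_mem (neg_Xv_mem_positiveCone g 3 le_rfl) n)
    rw [Function.iterate_succ_apply, pow_succ']
    refine (hmerge.map_Fop_iterate n).trans ?_
    convert ih (a := a + 1) (by omega) (by omega) using 3 <;> ring_nf

lemma Fop_iterate_dominates_lower {g : ℕ} (n : ℕ) {d : ℤ} (h1 : 1 ≤ d)
    (h2 : d ≤ (g : ℤ) - 1) (h3 : (n : ℤ) ≤ d + 1) :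
    Dominates g ((Fop g)^[n] (-Xv g (2 * n) (2 * d))) (-Xv g 0 (2 * d)) := by
  induction n with
  | zero => simpa using Dominates.refl _
  | succ n ih =>
    push_cast at h3 ⊢
    have hmem : (2 * ((n : ℤ) + 1), 2 * d) ∈ Sg g := by
      refine ⟨by simp only; omega, by simp only; omega, by simp only; omega, by simp only; omega,
        ⟨n + 1 + d, by simp only; ring⟩, ?_⟩
      intro h
      have := (Prod.mk.inj h).2
      omega
    rw [Function.iterate_succ_apply]
    refine ((Fop_dominates_lower hmem (by omega)).map_Fop_iterate n).trans ?_
    convert ih (by omega) using 4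
    ring

/-- The linear coefficient of `x_{0,2d}` in `F^{g+1}(x_{3d-g+2,3d-g} x_{3,1}^{g-d})`, with
`x` replaced by `-x`, is negative when `g < 3d`. -/
lemma constantCoeff_pd_neg {g : ℕ} {d : ℕ} (h1 : g < 3 * d) (h2 : d + 1 ≤ g) :
    constantCoeff (pd g (0, 2 * (d : ℤ)) ((Fop g)^[g + 1]
      (-Xv g (3 * (d : ℤ) - g + 2) (3 * (d : ℤ) - g) * (-Xv g 3 1) ^ (g - d)))) < 0 := by
  have hmerge := (Fop_iterate_dominates_merge (g := g) (g - d) (a := 3 * (d : ℤ) - g)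
    (by omega) (by omega)).map_Fop_iterate (d + 1)
  rw [← Function.iterate_add_apply, show d + 1 + (g - d) = g + 1 by omega] at hmerge
  have e1 : 3 * (d : ℤ) - g + (g - d : ℕ) + 2 = 2 * ((d + 1 : ℕ) : ℤ) := by omega
  have e2 : 3 * (d : ℤ) - g + (g - d : ℕ) = 2 * (d : ℤ) := by omega
  rw [e1, e2] at hmerge
  obtain ⟨c, hc, h⟩ := hmerge.trans
    (Fop_iterate_dominates_lower (g := g) (d + 1) (d := d) (by omega) (by omega) (by omega))
  have hmem : ((0 : ℤ), 2 * (d : ℤ)) ∈ Sg g := by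
    refine ⟨le_rfl, by simp only; omega, by simp only; omega, by simp only; omega,
      ⟨d, by simp only; ring⟩, ?_⟩
    intro h
    have := (Prod.mk.inj h).2
    omega
  have hnn := constantCoeff_nonneg (neg_pd_mem_positiveCone (0, 2 * (d : ℤ)) h)
  rw [sub_eq_add_neg, pd_add, pd_neg, pd_C_mul, pd_neg, pd_Xv_self hmem] at hnn
  simp only [map_neg, map_add, map_mul, constantCoeff_C, map_one] at hnn
  linarith

end PositiveCone

lemma Fop_iterate_neg_one_pow_mul (g n k : ℕ) (P : JacA g) :
    (Fop g)^[n] ((-1) ^ k * P) = (-1) ^ k * (Fop g)^[n] P := by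
  have h : ((-1) ^ k : JacA g) = C ((-1) ^ k) := by simp
  induction n with
  | zero => rfl
  | succ n ih => rw [Function.iterate_succ_apply', ih, h, Fop_C_mul, Function.iterate_succ_apply']

/-- A subalgebra containing `y`, the `x_{0,2k}` with `k ≤ ⌊g/3⌋` and all the relations
`F^{g+1}(m)` contains every `x_{0,2d}`. -/
lemma Xv_mem_of_relations_mem {g : ℕ} (S : Subalgebra ℚ (JacA g)) (hY : Yv g ∈ S)
    (hX : ∀ k : ℤ, 1 ≤ k → k ≤ (g : ℤ) / 3 → Xv g 0 (2 * k) ∈ S)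
    (hF : ∀ (i : ℕ) (m : JacVar g →₀ ℕ),
      monomial m (1 : ℚ) ∈ Acomp g (2 * (g : ℤ) + 2) (2 * (i : ℤ)) →
      (Fop g)^[g + 1] (monomial m (1 : ℚ)) ∈ S)
    (d : ℕ) (hd1 : 1 ≤ d) (hd2 : d + 1 ≤ g) : Xv g 0 (2 * (d : ℤ)) ∈ S := by
  induction d using Nat.strong_induction_on with
  | _ d ih =>
  by_cases hd : 3 * d ≤ g
  · exact hX d (by omega) (by omega)
  push Not at hd
  have hp := add_two_mem_Sg (g := g) (a := 3 * (d : ℤ) - g) (by omega) (by omega)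
  have hq : ((3 : ℤ), (1 : ℤ)) ∈ Sg g := add_two_mem_Sg (g := g) (a := 1) le_rfl (by omega)
  set M : JacA g := Xv g (3 * (d : ℤ) - g + 2) (3 * (d : ℤ) - g) * Xv g 3 1 ^ (g - d) with hM
  have hMmem : M ∈ Acomp g (2 * (g : ℤ) + 2) (2 * (d : ℤ)) := by
    have hpow : Xv g 3 1 ^ (g - d) ∈ Acomp g (3 * ((g : ℤ) - d)) ((g : ℤ) - d) := by
      have := IsWeightedHomogeneous.pow (Xv_mem_Acomp g 3 1) (g - d)
      have e : (g - d) • ((3 : ℤ), (1 : ℤ)) = (3 * ((g : ℤ) - d), (g : ℤ) - d) := by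
        ext <;> simp <;> omega
      rwa [e] at this
    exact mul_mem_Acomp (Xv_mem_Acomp g _ _) hpow (by ring) (by ring)
  have hMS : (Fop g)^[g + 1] M ∈ S := by
    have hmon : M = monomial (Finsupp.single (Sum.inl ⟨_, hp⟩) 1 +
        Finsupp.single (Sum.inl ⟨_, hq⟩) (g - d)) (1 : ℚ) := by
      rw [hM, Xv_of_mem hp, Xv_of_mem hq, X_pow_eq_monomial, X, monomial_mul, one_mul]
    rw [hmon] at hMmem ⊢
    exact hF d _ hMmem
  set a := constantCoeff (pd g (0, 2 * (d : ℤ)) ((Fop g)^[g + 1] M)) with ha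
  have ha0 : a ≠ 0 := by
    have hneg := constantCoeff_pd_neg (g := g) (d := d) hd hd2
    have e : -Xv g (3 * (d : ℤ) - g + 2) (3 * (d : ℤ) - g) * (-Xv g 3 1) ^ (g - d) =
        (-1) ^ (g - d + 1) * M := by
      rw [hM, neg_pow (Xv g 3 1)]; ring
    have e' : ((-1) ^ (g - d + 1) : JacA g) = C ((-1) ^ (g - d + 1)) := by simp
    rw [e, Fop_iterate_neg_one_pow_mul, e', pd_C_mul, map_mul] at hneg
    exact right_ne_zero_of_mul hneg.ne
  have hFM : (Fop g)^[g + 1] M ∈ Acomp g 0 (2 * (d : ℤ)) := by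
    convert Fop_iterate_mem_Acomp hMmem (g + 1) using 2
    push_cast; ring
  have hlin := sub_linear_mem S hY (fun k h1 h2 _ => by
    lift k to ℕ using by omega
    exact ih k (by omega) (by omega) (by omega)) hFM
  have haX : C a * Xv g 0 (2 * (d : ℤ)) ∈ S := by
    simpa [ha] using sub_mem hMS hlin
  have := mul_mem (S.algebraMap_mem a⁻¹) haX
  rwa [algebraMap_eq, ← mul_assoc, ← C_mul, inv_mul_cancel₀ ha0, C_1, one_mul] at this

/-- The quotient `R̃ = B/J` is generated as a `ℚ`-algebra by the image
of `y` together with the images of `x_{0,2}, …, x_{0,2⌊g/3⌋}`. -/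
theorem statement_3 (g : ℕ) (hg : 1 ≤ g) :
    Algebra.adjoin ℚ
      ((Ideal.Quotient.mk (Jid g)) ''
        {b : Bsub g | (b : JacA g) = Yv g ∨
          ∃ k : ℤ, 1 ≤ k ∧ k ≤ (g : ℤ) / 3 ∧ (b : JacA g) = Xv g 0 (2 * k)}) = ⊤ := by
  set T := Algebra.adjoin ℚ
      ((Ideal.Quotient.mk (Jid g)) ''
        {b : Bsub g | (b : JacA g) = Yv g ∨
          ∃ k : ℤ, 1 ≤ k ∧ k ≤ (g : ℤ) / 3 ∧ (b : JacA g) = Xv g 0 (2 * k)}) with hT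
  set S : Subalgebra ℚ (JacA g) :=
    (T.comap (Ideal.Quotient.mkₐ ℚ (Jid g))).map (Bsub g).val with hS
  have mem_S : ∀ b : Bsub g, Ideal.Quotient.mk (Jid g) b ∈ T → (b : JacA g) ∈ S :=
    fun b hb => ⟨b, hb, rfl⟩
  have hY : Yv g ∈ S :=
    mem_S ⟨Yv g, Algebra.subset_adjoin (Or.inl rfl)⟩
      (Algebra.subset_adjoin ⟨_, Or.inl rfl, rfl⟩)
  have hX : ∀ d : ℕ, 1 ≤ d → d + 1 ≤ g → Xv g 0 (2 * (d : ℤ)) ∈ S := by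
    refine Xv_mem_of_relations_mem S hY (fun k h1 h2 => ?_) fun i m hm => ?_
    · exact mem_S ⟨Xv g 0 (2 * k), Algebra.subset_adjoin (Or.inr ⟨k, h1, by omega, rfl⟩)⟩
        (Algebra.subset_adjoin ⟨_, Or.inr ⟨k, h1, h2, rfl⟩, rfl⟩)
    · have hB : (Fop g)^[g + 1] (monomial m (1 : ℚ)) ∈ Bsub g := by
        refine Acomp_zero_le_Bsub i ?_
        convert Fop_iterate_mem_Acomp hm (g + 1) using 2
        push_cast; ring
      refine mem_S ⟨_, hB⟩ ?_
      have hJ : (⟨_, hB⟩ : Bsub g) ∈ Jid g := Ideal.subset_span ⟨i, m, hm, rfl⟩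
      rw [Ideal.Quotient.eq_zero_iff_mem.mpr hJ]
      exact zero_mem _
  have hBS : Bsub g ≤ S := by
    refine Algebra.adjoin_le ?_
    rintro P (rfl | ⟨k, h1, h2, rfl⟩)
    · exact hY
    · lift k to ℕ using by omega
      exact hX k (by omega) (by omega)
  refine eq_top_iff.mpr fun r _ => ?_
  obtain ⟨b, rfl⟩ := Ideal.Quotient.mk_surjective r
  obtain ⟨b', hb', e⟩ := hBS b.2
  obtain rfl : b' = b := Subtype.ext e
  exact hb'
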